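/- Let M be a transitive relational Fraïssé structure whose age has the 3-disjoint amalgamation property. Then M has the galah property, and hence M has the infinite sunflower property. -/

import Mathlib

open FirstOrder FirstOrder.Language Set CategoryTheory

universe u v w x

section Defs

variable (L : FirstOrder.Language.{u, v}) (M : Type w) [L.Structure M]

/-- `X ⊆ M` contains a copy of `M`: there is a substructure of `M` with domain
contained in `X` that is isomorphic to `M`. -/
def ContainsCopy (X : Set M) : Prop :=
  ∃ S : L.Substructure M, (S : Set M) ⊆ X ∧ Nonempty (S ≃[L] M)

/-- The induced substructure on `C` is isomorphic to `M`. -/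
def IsCopy (C : Set M) : Prop :=
  ∃ S : L.Substructure M, (S : Set M) = C ∧ Nonempty (S ≃[L] M)

/-- The galah property: for every partition `(C, Cᶜ)` of the domain of `M`, either the
induced substructure on `C` is isomorphic to `M`, or `Cᶜ` contains a copy of `M`. -/
def GalahProperty : Prop := ∀ C : Set M, IsCopy L M C ∨ ContainsCopy L M Cᶜ

/-- Indivisibility: for every partition `(C, Cᶜ)` of the domain of `M`, one of the two
parts contains a copy of `M`. -/
def Indivisible : Prop := ∀ C : Set M, ContainsCopy L M C ∨ ContainsCopy L M Cᶜ

/-- `v` and `b` realize the same quantifier-free type over the parameter set `A`. -/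
def SameQfTypeOver (A : Set M) (v b : M) : Prop :=
  ∀ (n : ℕ) (φ : L.Formula (Fin (n + 1))), φ.IsQF →
    ∀ g : Fin n → M, (∀ i, g i ∈ A) →
      (φ.Realize (Fin.cons v g) ↔ φ.Realize (Fin.cons b g))

/-- Local replicability: every basic open set
`{v : M | qftp(v / A) = qftp(b / A)}`, for `A` a finite substructure of `M` and
`b ∈ M \\ A`, contains a copy of `M`. -/
def LocallyReplicable : Prop :=
  ∀ A : L.Substructure M, (A : Set M).Finite → ∀ b : M, b ∉ (A : Set M) →
    ContainsCopy L M {v : M | SameQfTypeOver L M (A : Set M) v b}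

/-- The infinite `k`-sunflower property: every structure on `k`-sets isomorphic to `M`
contains an induced substructure isomorphic to `M` whose domain is a sunflower. -/
def InfiniteKSunflowerProperty (k : ℕ) : Prop :=
  ∀ (α : Type x) (X : Set (Finset α)), (∀ v ∈ X, v.card = k) →
    ∀ [L.Structure ↥X], Nonempty (M ≃[L] ↥X) →
      ∃ (f : M ↪[L] ↥X) (c : Set α),
        ∀ a b : M, a ≠ b →
          ((f a : Finset α) : Set α) ∩ ((f b : Finset α) : Set α) = c

/-- The infinite sunflower property: the infinite `k`-sunflower property for all `k ≥ 1`. -/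
def InfiniteSunflowerProperty : Prop :=
  ∀ k : ℕ, 1 ≤ k → InfiniteKSunflowerProperty.{u, v, w, x} L M k

/-- A class of structures has strong amalgamation if any two embeddings from a common
structure can be amalgamated so that the images of the two structures intersect exactly
in the image of the common structure. -/
def HasStrongAmalgamation (K : Set (Bundled.{w} L.Structure)) : Prop :=
  ∀ A B₀ B₁ : Bundled.{w} L.Structure, A ∈ K → B₀ ∈ K → B₁ ∈ K →
    ∀ (f₀ : A ↪[L] B₀) (f₁ : A ↪[L] B₁),
      ∃ C : Bundled.{w} L.Structure, C ∈ K ∧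
        ∃ (g₀ : B₀ ↪[L] C) (g₁ : B₁ ↪[L] C),
          g₀.comp f₀ = g₁.comp f₁ ∧
          Set.range g₀ ∩ Set.range g₁ = Set.range (g₀.comp f₀)

end Defs

/-- The 3-disjoint amalgamation property for a class `K`: the two-element subsets of
`{0, 1, 2}` are indexed by their missing element `k`, so `P k` plays the role of
`A_{\\{0,1,2\\} \\ \\{k\\}}`, `f i : A₀ ↪ A i` plays the role of `f_{∅,{i}}` and
`g i k _ : A i ↪ P k` (for `i ≠ k`) plays the role of `f_{{i}, {0,1,2}\\{k}}`. -/
def Has3DAP (L : FirstOrder.Language.{u, v}) (K : Set (Bundled.{w} L.Structure)) : Prop :=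
  ∀ (A₀ : Bundled.{w} L.Structure) (A P : Fin 3 → Bundled.{w} L.Structure),
    A₀ ∈ K → (∀ i, A i ∈ K) → (∀ k, P k ∈ K) →
    ∀ (f : ∀ i : Fin 3, A₀ ↪[L] A i)
      (g : ∀ i k : Fin 3, i ≠ k → (A i ↪[L] P k)),
      (∀ (i j k : Fin 3) (hik : i ≠ k) (hjk : j ≠ k), i ≠ j →
        ((g i k hik).comp (f i) = (g j k hjk).comp (f j)) ∧
        (Set.range (g i k hik) ∩ Set.range (g j k hjk)
          = Set.range ((g i k hik).comp (f i)))) →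
      ∃ B : Bundled.{w} L.Structure, B ∈ K ∧
        ∃ h : ∀ k : Fin 3, P k ↪[L] B,
          ∀ (i k k' : Fin 3) (hik : i ≠ k) (hik' : i ≠ k'), k ≠ k' →
            (h k).comp (g i k hik) = (h k').comp (g i k' hik')

section Helpers

variable {L : FirstOrder.Language.{u, v}} {M : Type w} [L.Structure M]

theorem containsCopy_iff_exists_embedding {X : Set M} :
    ContainsCopy L M X ↔ ∃ f : M ↪[L] M, ∀ a, f a ∈ X := by
  constructor
  · rintro ⟨S, hS, ⟨e⟩⟩
    exact ⟨S.subtype.comp e.symm.toEmbedding, fun a => hS (e.symm a).2⟩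
  · rintro ⟨f, hf⟩
    refine ⟨f.toHom.range, ?_, ⟨f.equivRange.symm⟩⟩
    rintro _ ⟨a, rfl⟩
    exact hf a

theorem isCopy_of_embedding (f : M ↪[L] M) : IsCopy L M (Set.range f) :=
  ⟨f.toHom.range, rfl, ⟨f.equivRange.symm⟩⟩

/-- A back-and-forth argument: finite restrictions of automorphisms satisfying `G` are glued
to a self-embedding whose range contains `C`. -/
theorem exists_embedding_of_extensions [L.IsRelational] [Countable M]
    (G : Finset M → (M ≃[L] M) → Prop) (C : Set M) (start : G ∅ (FirstOrder.Language.Equiv.refl L M))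
    (forth : ∀ F p, G F p → ∀ m, ∃ F' p', G F' p' ∧ F ⊆ F' ∧ (∀ x ∈ F, p' x = p x) ∧ m ∈ F')
    (back : ∀ F p, G F p → ∀ c ∈ C, ∃ F' p', G F' p' ∧ F ⊆ F' ∧ (∀ x ∈ F, p' x = p x) ∧
      ∃ x ∈ F', p' x = c) :
    ∃ f : M ↪[L] M,
      (∀ X : Set M, X.Finite → ∃ F p, G F p ∧ ∀ x ∈ X, x ∈ F ∧ f x = p x) ∧
      C ⊆ Set.range f := by
  let P := {s : Finset M × (M ≃[L] M) // G s.1 s.2}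
  let _ : Preorder P :=
    { le := fun s t => s.1.1 ⊆ t.1.1 ∧ ∀ x ∈ s.1.1, t.1.2 x = s.1.2 x
      le_refl := fun s => ⟨subset_rfl, fun _ _ => rfl⟩
      le_trans := fun s t r hst htr =>
        ⟨hst.1.trans htr.1, fun x hx => (htr.2 x (hst.1 hx)).trans (hst.2 x hx)⟩ }
  let D : M ⊕ C → Order.Cofinal P
    | .inl m => ⟨{s | m ∈ s.1.1}, fun s => by
        obtain ⟨F', p', hG, hF, hp, hm⟩ := forth _ _ s.2 m
        exact ⟨⟨(F', p'), hG⟩, hm, hF, hp⟩⟩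
    | .inr c => ⟨{s | ∃ x ∈ s.1.1, s.1.2 x = c}, fun s => by
        obtain ⟨F', p', hG, hF, hp, hm⟩ := back _ _ s.2 c c.2
        exact ⟨⟨(F', p'), hG⟩, hm, hF, hp⟩⟩
  let _ : Encodable (M ⊕ C) := Encodable.ofCountable _
  let q : ℕ → P := Order.sequenceOfCofinals ⟨(∅, FirstOrder.Language.Equiv.refl L M), start⟩ D
  have hq : Monotone q := Order.sequenceOfCofinals.monotone _ D
  let N : M → ℕ := fun m => Encodable.encode (Sum.inl m : M ⊕ C) + 1
  have hN : ∀ m, m ∈ (q (N m)).1.1 := fun m =>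
    Order.sequenceOfCofinals.encode_mem _ D (Sum.inl m)
  let f : M → M := fun m => (q (N m)).1.2 m
  have hf : ∀ m n, m ∈ (q n).1.1 → (q n).1.2 m = f m := by
    intro m n hm
    rcases le_total n (N m) with h | h
    · exact ((hq h).2 m hm).symm
    · exact (hq h).2 m (hN m)
  have hfin : ∀ X : Set M, X.Finite → ∃ n, ∀ x ∈ X, x ∈ (q n).1.1 ∧ f x = (q n).1.2 x := by
    intro X hX
    obtain ⟨n, hn⟩ := (hX.image N).bddAbove
    refine ⟨n, fun x hx => ?_⟩
    have hle := hn (Set.mem_image_of_mem N hx)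
    exact ⟨(hq hle).1 (hN x), ((hq hle).2 x (hN x)).symm⟩
  refine ⟨⟨⟨f, ?_⟩, ?_, ?_⟩, ?_, ?_⟩
  · intro a b hab
    obtain ⟨n, hn⟩ := hfin {a, b} (Set.toFinite _)
    rw [(hn a (by simp)).2, (hn b (by simp)).2] at hab
    exact (q n).1.2.injective hab
  · intro n F
    exact isEmptyElim F
  · intro k R x
    obtain ⟨n, hn⟩ := hfin (Set.range x) (Set.finite_range x)
    have : f ∘ x = (q n).1.2 ∘ x := funext fun i => (hn _ ⟨i, rfl⟩).2
    change Structure.RelMap R (f ∘ x) ↔ _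
    rw [this]
    exact (q n).1.2.map_rel R x
  · intro X hX
    obtain ⟨n, hn⟩ := hfin X hX
    exact ⟨_, _, (q n).2, hn⟩
  · intro c hc
    obtain ⟨x, hx, hxc⟩ : ∃ x ∈ (q (Encodable.encode (Sum.inr ⟨c, hc⟩ : M ⊕ C) + 1)).1.1,
        (q (Encodable.encode (Sum.inr ⟨c, hc⟩ : M ⊕ C) + 1)).1.2 x = c :=
      Order.sequenceOfCofinals.encode_mem _ D (Sum.inr ⟨c, hc⟩)
    exact ⟨x, (hf x _ hx).symm.trans hxc⟩

/-- In an ultrahomogeneous structure, 3-disjoint amalgamation of finite substructures over the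
empty structure is realised by automorphisms. -/
theorem Has3DAP.exists_equiv [L.IsRelational] (h3 : Has3DAP L (L.age M))
    (hM : L.IsUltrahomogeneous M) (S T : Fin 3 → Set M) (hS : ∀ i, (S i).Finite)
    (hT : ∀ k, (T k).Finite) (σ : Fin 3 → Fin 3 → (M ≃[L] M))
    (hσ : ∀ i k, i ≠ k → ∀ a ∈ S i, σ i k a ∈ T k)
    (hdisj : ∀ i j k, i ≠ k → j ≠ k → i ≠ j → ∀ a ∈ S i, ∀ b ∈ S j, σ i k a ≠ σ j k b) :
    ∃ η : Fin 3 → (M ≃[L] M), ∀ i k k', i ≠ k → i ≠ k' → k ≠ k' →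
      ∀ a ∈ S i, η k (σ i k a) = η k' (σ i k' a) := by
  have hage : ∀ X : Set M, X.Finite →
      (⟨Substructure.closure L X, inferInstance⟩ : Bundled.{w} L.Structure) ∈ L.age M := fun X hX =>
    ⟨(Substructure.fg_iff_structure_fg _).1 (Substructure.fg_closure hX),
      ⟨(Substructure.closure L X).subtype⟩⟩
  have hempty : IsEmpty (Substructure.closure L (∅ : Set M)) :=
    ⟨fun x => (Substructure.mem_closure_iff_of_isRelational L _ _).1 x.2⟩
  obtain ⟨B, ⟨-, ⟨ι⟩⟩, h, hh⟩ := h3 ⟨Substructure.closure L (∅ : Set M), inferInstance⟩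
    (fun i => ⟨Substructure.closure L (S i), inferInstance⟩)
    (fun k => ⟨Substructure.closure L (T k), inferInstance⟩)
    (hage _ Set.finite_empty) (fun i => hage _ (hS i)) (fun k => hage _ (hT k))
    (fun i => Substructure.inclusion ((Substructure.closure L).monotone (Set.empty_subset _)))
    (fun i k hik => ((σ i k).toEmbedding.comp (Substructure.subtype _)).codRestrict _
      (fun x => (Substructure.mem_closure_iff_of_isRelational L _ _).2
        (hσ i k hik _ ((Substructure.mem_closure_iff_of_isRelational L _ _).1 x.2))))
    (by
      intro i j k hik hjk hij
      constructor
      · ext x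
        exact hempty.elim x
      · ext y
        constructor
        · rintro ⟨⟨a, rfl⟩, ⟨b, hb⟩⟩
          exact (hdisj i j k hik hjk hij a
            ((Substructure.mem_closure_iff_of_isRelational L _ _).1 a.2) b
            ((Substructure.mem_closure_iff_of_isRelational L _ _).1 b.2)
            (congrArg Subtype.val hb).symm).elim
        · rintro ⟨x, -⟩
          exact hempty.elim x)
  choose η hη using fun k =>
    hM (Substructure.closure L (T k)) (Substructure.fg_closure (hT k)) (ι.comp (h k))
  have key : ∀ k y (hy : y ∈ Substructure.closure L (T k)), η k y = ι (h k ⟨y, hy⟩) :=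
    fun k y hy => (DFunLike.congr_fun (hη k) ⟨y, hy⟩).symm
  have hcl : ∀ i k, i ≠ k → ∀ a ∈ S i, σ i k a ∈ Substructure.closure L (T k) :=
    fun i k hik a ha => (Substructure.mem_closure_iff_of_isRelational L _ _).2 (hσ i k hik a ha)
  refine ⟨η, fun i k k' hik hik' hkk' a ha => ?_⟩
  rw [key k _ (hcl i k hik a ha), key k' _ (hcl i k' hik' a ha)]
  exact congrArg ι (DFunLike.congr_fun (hh i k k' hik hik' hkk')
    ⟨a, (Substructure.mem_closure_iff_of_isRelational L _ _).2 ha⟩)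

/-- Two one-point types over disjoint finite sets have a common realisation. -/
theorem exists_common_realization [L.IsRelational] (hM : L.IsUltrahomogeneous M)
    (htrans : ∀ v w : M, ∃ g : M ≃[L] M, g v = w) (h3 : Has3DAP L (L.age M))
    {A B : Set M} (hA : A.Finite) (hB : B.Finite) (hAB : ∀ a ∈ A, a ∉ B) {b c : M}
    (hb : b ∉ A) (hc : c ∉ B) :
    ∃ g h : M ≃[L] M, (∀ a ∈ A, g a = a) ∧ (∀ x ∈ B, h x = x) ∧ g b = h c := by
  obtain ⟨τ, hτ⟩ := htrans c b
  let e := FirstOrder.Language.Equiv.refl L M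
  obtain ⟨η, hη⟩ := h3.exists_equiv hM ![A, B, {c}] ![insert c B, insert b A, A ∪ B]
    (by intro i; fin_cases i <;> simp [hA, hB])
    (by intro i; fin_cases i <;> simp [hA, hB])
    ![![e, e, e], ![e, e, e], ![e, τ, e] ]
    (by
      intro i k hik a ha
      fin_cases i <;> fin_cases k <;> simp_all [e])
    (by
      intro i j k hik hjk hij a ha b hb
      fin_cases i <;> fin_cases j <;> fin_cases k <;> simp_all [e] <;> grind)
  have hηA : ∀ a ∈ A, η 1 a = η 2 a := fun a ha =>
    hη 0 1 2 (by decide) (by decide) (by decide) a ha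
  have hηB : ∀ a ∈ B, η 0 a = η 2 a := fun a ha =>
    hη 1 0 2 (by decide) (by decide) (by decide) a ha
  have hηc : η 0 c = η 1 (τ c) := hη 2 0 1 (by decide) (by decide) (by decide) c rfl
  refine ⟨(η 2).symm.comp (η 1), (η 2).symm.comp (η 0), fun a ha => ?_, fun a ha => ?_, ?_⟩
  · simp [hηA a ha]
  · simp [hηB a ha]
  · simp [hηc, hτ]

/-- The realisations of a one-point type over a finite set contain a copy of the structure. -/
theorem containsCopy_orbit [L.IsRelational] [Countable M] (hM : L.IsUltrahomogeneous M)
    (htrans : ∀ v w : M, ∃ g : M ≃[L] M, g v = w) (h3 : Has3DAP L (L.age M))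
    {A : Set M} (hA : A.Finite) {b : M} (hb : b ∉ A) :
    ContainsCopy L M {v | ∃ g : M ≃[L] M, (∀ a ∈ A, g a = a) ∧ g b = v} := by
  classical
  rw [containsCopy_iff_exists_embedding]
  obtain ⟨f, hf, -⟩ := exists_embedding_of_extensions (L := L)
    (fun F p => ∀ x ∈ F, ∃ g : M ≃[L] M, (∀ a ∈ A, g a = a) ∧ g b = p x) ∅ (by simp)
    (by
      intro F p hF m
      by_cases hm : m ∈ F
      · exact ⟨F, p, hF, subset_rfl, fun _ _ => rfl, hm⟩
      obtain ⟨g, h, hg, hh, hgh⟩ := exists_common_realization hM htrans h3 hA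
        ((F.finite_toSet).image p) (b := b) (c := p m)
        (by
          rintro a ha ⟨x, hx, rfl⟩
          obtain ⟨g, hg, hgb⟩ := hF x hx
          rw [← hg _ ha] at hgb
          exact hb (g.injective hgb ▸ ha)) hb
        (by
          rintro ⟨x, hx, hxm⟩
          exact hm (p.injective hxm ▸ hx))
      have hfix : ∀ x ∈ F, (h.comp p) x = p x := fun x hx => hh _ ⟨x, hx, rfl⟩
      refine ⟨insert m F, h.comp p, ?_, Finset.subset_insert _ _, hfix,
        Finset.mem_insert_self _ _⟩
      intro x hx
      rcases Finset.mem_insert.1 hx with rfl | hx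
      · exact ⟨g, hg, hgh⟩
      · rw [hfix x hx]
        exact hF x hx)
    (by simp)
  refine ⟨f, fun a => ?_⟩
  obtain ⟨F, p, hG, hp⟩ := hf {a} (Set.finite_singleton a)
  obtain ⟨haF, hap⟩ := hp a rfl
  rw [hap]
  exact hG a haF

/-- A subset realising all one-point types over its finite subsets is a copy. -/
theorem isCopy_of_realizes_types [L.IsRelational] [Countable M] {C : Set M}
    (hC : ∀ A : Set M, A.Finite → A ⊆ C → ∀ b ∉ A,
      ∃ g : M ≃[L] M, (∀ a ∈ A, g a = a) ∧ g b ∈ C) : IsCopy L M C := by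
  classical
  obtain ⟨f, hf, hCf⟩ := exists_embedding_of_extensions (L := L)
    (fun F p => ∀ x ∈ F, p x ∈ C) C (by simp)
    (by
      intro F p hF m
      by_cases hm : m ∈ F
      · exact ⟨F, p, hF, subset_rfl, fun _ _ => rfl, hm⟩
      obtain ⟨h, hh, hmC⟩ := hC (p '' F) ((F.finite_toSet).image p)
        (by rintro _ ⟨x, hx, rfl⟩; exact hF x hx) (p m)
        (by
          rintro ⟨x, hx, hxm⟩
          exact hm (p.injective hxm ▸ hx))
      have hfix : ∀ x ∈ F, (h.comp p) x = p x := fun x hx => hh _ ⟨x, hx, rfl⟩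
      refine ⟨insert m F, h.comp p, ?_, Finset.subset_insert _ _, hfix,
        Finset.mem_insert_self _ _⟩
      intro x hx
      rcases Finset.mem_insert.1 hx with rfl | hx
      · exact hmC
      · rw [hfix x hx]
        exact hF x hx)
    (by
      intro F p hF c hc
      refine ⟨insert (p.symm c) F, p, ?_, Finset.subset_insert _ _, fun _ _ => rfl,
        p.symm c, Finset.mem_insert_self _ _, by simp⟩
      intro x hx
      rcases Finset.mem_insert.1 hx with rfl | hx
      · simpa using hc
      · exact hF x hx)
  have hrange : Set.range f = C := by
    refine Set.Subset.antisymm ?_ hCf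
    rintro _ ⟨a, rfl⟩
    obtain ⟨F, p, hG, hp⟩ := hf {a} (Set.finite_singleton a)
    obtain ⟨haF, hap⟩ := hp a rfl
    rw [hap]
    exact hG a haF
  exact hrange ▸ isCopy_of_embedding f

theorem galahProperty_of_containsCopy_orbit [L.IsRelational] [Countable M]
    (horbit : ∀ A : Set M, A.Finite → ∀ b ∉ A,
      ContainsCopy L M {v | ∃ g : M ≃[L] M, (∀ a ∈ A, g a = a) ∧ g b = v}) :
    GalahProperty L M := by
  intro C
  by_cases hC : ∀ A : Set M, A.Finite → A ⊆ C → ∀ b ∉ A,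
      ∃ g : M ≃[L] M, (∀ a ∈ A, g a = a) ∧ g b ∈ C
  · exact .inl (isCopy_of_realizes_types hC)
  · push Not at hC
    obtain ⟨A, hA, -, b, hb, hgC⟩ := hC
    obtain ⟨S, hS, e⟩ := horbit A hA b hb
    refine .inr ⟨S, hS.trans ?_, e⟩
    rintro _ ⟨g, hg, rfl⟩
    exact hgC g hg

theorem GalahProperty.indivisible (h : GalahProperty L M) : Indivisible L M := by
  intro C
  rcases h C with ⟨S, hS, e⟩ | h
  · exact .inl ⟨S, hS.le, e⟩
  · exact .inr h

theorem ContainsCopy.of_union (h : Indivisible L M) {X Y : Set M}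
    (hXY : ContainsCopy L M (X ∪ Y)) : ContainsCopy L M X ∨ ContainsCopy L M Y := by
  simp only [Indivisible, containsCopy_iff_exists_embedding] at *
  obtain ⟨f, hf⟩ := hXY
  rcases h (f ⁻¹' X) with ⟨g, hg⟩ | ⟨g, hg⟩
  · exact .inl ⟨f.comp g, hg⟩
  · exact .inr ⟨f.comp g, fun a => (hf (g a)).resolve_left (hg a)⟩

theorem ContainsCopy.of_biUnion [Nonempty M] (h : Indivisible L M) {ι : Type*} (F : Finset ι)
    (X : ι → Set M) (hX : ContainsCopy L M {a | ∃ i ∈ F, a ∈ X i}) :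
    ∃ i ∈ F, ContainsCopy L M (X i) := by
  classical
  induction F using Finset.induction_on with
  | empty =>
    obtain ⟨f, hf⟩ := containsCopy_iff_exists_embedding.1 hX
    simpa using hf (Classical.arbitrary M)
  | insert i F _ ih =>
    have hunion : {a | ∃ j ∈ insert i F, a ∈ X j} = X i ∪ {a | ∃ j ∈ F, a ∈ X j} := by
      ext a
      simp
    rw [hunion] at hX
    rcases hX.of_union h with hX | hX
    · exact ⟨i, Finset.mem_insert_self _ _, hX⟩
    · obtain ⟨j, hj, hX⟩ := ih hX
      exact ⟨j, Finset.mem_insert_of_mem hj, hX⟩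

/-- If no point lies in `s a` for a whole copy's worth of `a`, then some copy has pairwise
disjoint `s a`. -/
theorem exists_embedding_disjoint [L.IsRelational] [Countable M] [Nonempty M]
    (hind : Indivisible L M)
    (horbit : ∀ A : Set M, A.Finite → ∀ b ∉ A,
      ContainsCopy L M {v | ∃ g : M ≃[L] M, (∀ a ∈ A, g a = a) ∧ g b = v})
    {α : Type x} (s : M → Finset α) (hs : ∀ x, ¬ ContainsCopy L M {a | x ∈ s a}) :
    ∃ f : M ↪[L] M, ∀ a b, a ≠ b → Disjoint (s (f a)) (s (f b)) := by
  classical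
  obtain ⟨f, hf, -⟩ := exists_embedding_of_extensions (L := L)
    (fun F p => ∀ x ∈ F, ∀ y ∈ F, x ≠ y → Disjoint (s (p x)) (s (p y))) ∅ (by simp)
    (by
      intro F p hF m
      by_cases hm : m ∈ F
      · exact ⟨F, p, hF, subset_rfl, fun _ _ => rfl, hm⟩
      obtain ⟨f, hf⟩ := containsCopy_iff_exists_embedding.1 <|
        horbit (p '' F) ((F.finite_toSet).image p) (p m)
          (by
            rintro ⟨x, hx, hxm⟩
            exact hm (p.injective hxm ▸ hx))
      obtain ⟨a, ha⟩ : ∃ a, ∀ x ∈ F.biUnion fun y => s (p y), x ∉ s (f a) := by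
        by_contra! hcon
        obtain ⟨x, -, hx⟩ := ContainsCopy.of_biUnion hind (F.biUnion fun y => s (p y))
          (fun x => {a | x ∈ s a}) (containsCopy_iff_exists_embedding.2 ⟨f, hcon⟩)
        exact hs x hx
      obtain ⟨h, hh, hha⟩ := hf a
      have hfix : ∀ x ∈ F, (h.comp p) x = p x := fun x hx => hh _ ⟨x, hx, rfl⟩
      have hdisj : ∀ x ∈ F, Disjoint (s ((h.comp p) x)) (s ((h.comp p) m)) := by
        intro x hx
        rw [hfix x hx, Finset.disjoint_left]
        intro z hz hzm
        refine ha z (Finset.mem_biUnion.2 ⟨x, hx, hz⟩) ?_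
        rw [← hha]
        exact hzm
      refine ⟨insert m F, h.comp p, ?_, Finset.subset_insert _ _, hfix,
        Finset.mem_insert_self _ _⟩
      intro x hx y hy hxy
      rcases Finset.mem_insert.1 hx with rfl | hxF <;>
        rcases Finset.mem_insert.1 hy with rfl | hyF
      · exact absurd rfl hxy
      · exact (hdisj y hyF).symm
      · exact hdisj x hxF
      · rw [hfix x hxF, hfix y hyF]
        exact hF x hxF y hyF hxy)
    (by simp)
  refine ⟨f, fun a b hab => ?_⟩
  obtain ⟨F, p, hG, hp⟩ := hf {a, b} (Set.toFinite _)
  obtain ⟨haF, hap⟩ := hp a (by simp)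
  obtain ⟨hbF, hbp⟩ := hp b (by simp)
  rw [hap, hbp]
  exact hG a haF b hbF hab

theorem exists_embedding_sunflower [L.IsRelational] [Countable M] [Infinite M]
    (hind : Indivisible L M)
    (horbit : ∀ A : Set M, A.Finite → ∀ b ∉ A,
      ContainsCopy L M {v | ∃ g : M ≃[L] M, (∀ a ∈ A, g a = a) ∧ g b = v})
    {α : Type x} (k : ℕ) (s : M → Finset α) (hinj : Function.Injective s)
    (hcard : ∀ a, (s a).card = k) :
    ∃ (f : M ↪[L] M) (c : Set α), ∀ a b, a ≠ b → (s (f a) : Set α) ∩ (s (f b) : Set α) = c := by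
  classical
  induction k generalizing s with
  | zero =>
    obtain ⟨a, b, hab⟩ := exists_pair_ne M
    exact absurd (hinj ((Finset.card_eq_zero.1 (hcard a)).trans
      (Finset.card_eq_zero.1 (hcard b)).symm)) hab
  | succ k ih =>
    by_cases hx : ∃ x, ContainsCopy L M {a | x ∈ s a}
    · obtain ⟨x, hx⟩ := hx
      obtain ⟨g, hg⟩ := containsCopy_iff_exists_embedding.1 hx
      obtain ⟨f, c, hf⟩ := ih (fun a => (s (g a)).erase x)
        (fun a b hab => g.injective <| hinj <| by
          rw [← Finset.insert_erase (hg a), ← Finset.insert_erase (hg b)]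
          exact congrArg (insert x) hab)
        (fun a => by rw [Finset.card_erase_of_mem (hg a), hcard, Nat.add_sub_cancel])
      refine ⟨g.comp f, insert x c, fun a b hab => ?_⟩
      rw [← hf a b hab, Set.insert_inter_distrib, ← Finset.coe_insert, ← Finset.coe_insert,
        Finset.insert_erase (hg _), Finset.insert_erase (hg _)]
      rfl
    · obtain ⟨f, hf⟩ := exists_embedding_disjoint hind horbit s (not_exists.1 hx)
      exact ⟨f, ∅, fun a b hab => (Finset.disjoint_coe.2 (hf a b hab)).inter_eq⟩

end Helpers

/-- A transitive relational Fraïssé structure whose age has the 3-disjoint amalgamation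
property has the galah property, and hence the infinite sunflower property. -/
theorem statement10 (L : FirstOrder.Language.{u, v}) [L.IsRelational]
    (M : Type w) [L.Structure M] [Countable M] [Infinite M]
    (hM : L.IsUltrahomogeneous M)
    (htrans : ∀ v w : M, ∃ g : M ≃[L] M, g v = w)
    (h3 : Has3DAP L (L.age M)) :
    GalahProperty L M ∧ InfiniteSunflowerProperty.{u, v, w, x} L M := by
  have horbit : ∀ A : Set M, A.Finite → ∀ b ∉ A,
      ContainsCopy L M {v | ∃ g : M ≃[L] M, (∀ a ∈ A, g a = a) ∧ g b = v} :=
    fun A hA b hb => containsCopy_orbit hM htrans h3 hA hb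
  have hgalah := galahProperty_of_containsCopy_orbit horbit
  refine ⟨hgalah, fun k _ α X hX _ ⟨e⟩ => ?_⟩
  obtain ⟨f, c, hf⟩ := exists_embedding_sunflower hgalah.indivisible horbit k
    (fun a => (e a : Finset α)) (Subtype.val_injective.comp e.injective) (fun a => hX _ (e a).2)
  exact ⟨e.toEmbedding.comp f, c, hf⟩
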